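/- For n ≥ 4, the number of fully commutative elements w of the Coxeter group W(Dₙ) of type I — those such that some reduced word for w contains the two-letter word s_{1̄} s₁ as a contiguous subword — equals catalan n − 1. -/

import Mathlib

noncomputable section

/-- Adjacency in the Coxeter graph of type `Dₙ`: the index set is `Fin n`, where `0`
stands for the generator `s₁̄` and `k` stands for `sₖ` for `1 ≤ k ≤ n − 1`.  The vertex
`s₁̄` is joined to `s₂`, and the vertices `s₁, …, s_{n−1}` form a path. -/
def DnAdj (n : ℕ) (i j : Fin n) : Prop :=
  ((i : ℕ) = 0 ∧ (j : ℕ) = 2) ∨ ((j : ℕ) = 0 ∧ (i : ℕ) = 2) ∨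
    (1 ≤ (i : ℕ) ∧ 1 ≤ (j : ℕ) ∧ ((i : ℕ) + 1 = (j : ℕ) ∨ (j : ℕ) + 1 = (i : ℕ)))

instance (n : ℕ) (i j : Fin n) : Decidable (DnAdj n i j) := by
  unfold DnAdj; infer_instance

theorem DnAdj.symm {n : ℕ} {i j : Fin n} (h : DnAdj n i j) : DnAdj n j i := by
  unfold DnAdj at *; tauto

/-- The Coxeter matrix of type `Dₙ`, with index set `Fin n`, where `0` stands for the
generator `s₁̄` and `k` stands for `sₖ` for `1 ≤ k ≤ n − 1`. -/
def DnMatrix (n : ℕ) : CoxeterMatrix (Fin n) where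
  M := Matrix.of fun i j => if i = j then 1 else if DnAdj n i j then 3 else 2
  isSymm := by
    ext i j
    simp only [Matrix.transpose_apply, Matrix.of_apply]
    by_cases h : i = j
    · subst h; simp
    · rw [if_neg h, if_neg (Ne.symm h)]
      by_cases h2 : DnAdj n i j
      · rw [if_pos h2, if_pos h2.symm]
      · rw [if_neg h2, if_neg (fun hc => h2 hc.symm)]
  diagonal := fun i => by simp
  off_diagonal := fun i j h => by
    simp only [Matrix.of_apply]
    rw [if_neg h]
    split <;> norm_num

/-- A *commutation move* on words: replace a contiguous subword `[i, j]` by `[j, i]`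
whenever `M i j = 2`. -/
def CommutationMoveRel {B : Type*} (M : CoxeterMatrix B) (ω ω' : List B) : Prop :=
  ∃ (i j : B) (l₁ l₂ : List B), M i j = 2 ∧
    ω = l₁ ++ [i, j] ++ l₂ ∧ ω' = l₁ ++ [j, i] ++ l₂

/-- `w` is *fully commutative* if any two reduced words for `w` are related by a sequence
of commutation moves. -/
def IsFullyCommutative {B : Type*} {W : Type*} [Group W] {M : CoxeterMatrix B}
    (cs : CoxeterSystem M W) (w : W) : Prop :=
  ∀ ω ω' : List B, cs.IsReduced ω → cs.IsReduced ω' →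
    cs.wordProd ω = w → cs.wordProd ω' = w →
    Relation.ReflTransGen (CommutationMoveRel M) ω ω'

section Exchange

/-! ### The exchange property -/

variable {B W : Type*} [Group W] {M : CoxeterMatrix B} (cs : CoxeterSystem M W)

/-- A Coxeter matrix is simply laced if its off-diagonal entries are `2` or `3`. -/
def IsSimplyLaced (M : CoxeterMatrix B) : Prop := ∀ i j, i ≠ j → M i j = 2 ∨ M i j = 3

theorem simple_commute {i j : B} (h : M i j = 2) :
    cs.simple i * cs.simple j = cs.simple j * cs.simple i := by
  have h1 := cs.simple_mul_simple_pow i j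
  rw [h, pow_two] at h1
  have := eq_inv_of_mul_eq_one_left h1
  simpa using this

theorem simple_braid {i j : B} (h : M i j = 3) :
    cs.simple i * (cs.simple j * cs.simple i) = cs.simple j * (cs.simple i * cs.simple j) := by
  have h1 := cs.simple_mul_simple_pow i j
  rw [h, pow_succ, pow_two] at h1
  have h2 : (cs.simple i * cs.simple j * cs.simple i) *
      (cs.simple j * cs.simple i * cs.simple j) = 1 := by
    rw [← h1]; simp only [mul_assoc]
  have := eq_inv_of_mul_eq_one_left h2
  simpa [mul_assoc] using this

open Classical in
/-- The indicator of equality, with values in `ZMod 2`. -/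
def eqParity (t u : W) : ZMod 2 := if t = u then 1 else 0

open Classical in
theorem eqParity_conj (i : B) (t u : W) :
    eqParity (cs.simple i * t * cs.simple i) u = eqParity t (cs.simple i * u * cs.simple i) := by
  have h : cs.simple i * t * cs.simple i = u ↔ t = cs.simple i * u * cs.simple i := by
    constructor
    · rintro rfl; simp [mul_assoc]
    · rintro rfl; simp [mul_assoc]
  exact if_congr h rfl rfl

theorem zmod_two_add_self (x : ZMod 2) : x + x = 0 := by
  revert x; decide

/-- Conjugation by a simple reflection, together with a sign that flips at that reflection. -/
def signedConj (i : B) : Equiv.Perm (W × ZMod 2) :=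
  Function.Involutive.toPerm
    (fun p => (cs.simple i * p.1 * cs.simple i, p.2 + eqParity p.1 (cs.simple i))) (by
      rintro ⟨t, ε⟩
      ext
      · simp [mul_assoc]
      · simp [eqParity_conj, add_assoc, zmod_two_add_self])

theorem signedConj_apply (i : B) (t : W) (ε : ZMod 2) :
    signedConj cs i (t, ε) =
      (cs.simple i * t * cs.simple i, ε + eqParity t (cs.simple i)) := rfl

theorem signedConj_isLiftable (hM : IsSimplyLaced M) : M.IsLiftable (signedConj cs) := by
  intro i j
  by_cases hij : i = j
  · subst hij
    ext1 p
    rw [M.diagonal, pow_one]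
    exact Function.Involutive.toPerm_involutive _ p
  rcases hM i j hij with h | h
  · have hc := simple_commute cs h
    have e1 : cs.simple j * cs.simple i * cs.simple j = cs.simple i := by
      rw [← hc]; simp
    have e2 : cs.simple i * cs.simple j * cs.simple i = cs.simple j := by
      rw [hc]; simp
    ext1 ⟨t, ε⟩
    simp only [h, pow_two, Equiv.Perm.mul_apply, signedConj_apply, eqParity_conj,
      Equiv.Perm.one_apply, cs.simple_mul_simple_self, one_mul, e1, e2]
    ext
    · have h4 := cs.simple_mul_simple_pow i j
      have h5 := cs.simple_mul_simple_pow' i j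
      rw [h, pow_two] at h4 h5
      calc _ = (cs.simple i * cs.simple j * (cs.simple i * cs.simple j)) * t *
            (cs.simple j * cs.simple i * (cs.simple j * cs.simple i)) := by simp only [mul_assoc]
        _ = t := by rw [h4, h5]; simp
    · linear_combination zmod_two_add_self (eqParity t (cs.simple j)) +
        zmod_two_add_self (eqParity t (cs.simple i))
  · have hb := simple_braid cs h
    have e1 : cs.simple j * (cs.simple i * cs.simple j * cs.simple i) * cs.simple j =
        cs.simple i := by
      rw [mul_assoc (cs.simple i), hb]; simp [mul_assoc]
    have e2 : cs.simple i * (cs.simple j * cs.simple i * cs.simple j) * cs.simple i =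
        cs.simple j := by
      rw [mul_assoc (cs.simple j), ← hb]; simp [mul_assoc]
    have e3 : cs.simple i * cs.simple j * cs.simple i =
        cs.simple j * cs.simple i * cs.simple j := by simpa only [mul_assoc] using hb
    have e4 : cs.simple j * (cs.simple j * cs.simple i * cs.simple j) * cs.simple j =
        cs.simple i := by simp [mul_assoc]
    ext1 ⟨t, ε⟩
    simp only [h, pow_succ, pow_zero, one_mul, Equiv.Perm.mul_apply, signedConj_apply,
      eqParity_conj, Equiv.Perm.one_apply, cs.simple_mul_simple_self, one_mul, e2, e3, e4]
    ext
    · have h4 := cs.simple_mul_simple_pow i j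
      have h5 := cs.simple_mul_simple_pow' i j
      rw [h, pow_succ, pow_two] at h4 h5
      calc _ = (cs.simple i * cs.simple j * (cs.simple i * cs.simple j) *
              (cs.simple i * cs.simple j)) * t *
            (cs.simple j * cs.simple i * (cs.simple j * cs.simple i) *
              (cs.simple j * cs.simple i)) := by simp only [mul_assoc]
        _ = t := by rw [h4, h5]; simp
    · linear_combination zmod_two_add_self (eqParity t (cs.simple j)) +
        zmod_two_add_self (eqParity t (cs.simple i)) +
        zmod_two_add_self (eqParity t (cs.simple j * cs.simple i * cs.simple j))

/-- The action of `W` on signed elements extending `signedConj`. -/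
def signedConjHom (hM : IsSimplyLaced M) : W →* Equiv.Perm (W × ZMod 2) :=
  cs.lift ⟨signedConj cs, signedConj_isLiftable cs hM⟩

theorem signedConjHom_simple (hM : IsSimplyLaced M) (i : B) :
    signedConjHom cs hM (cs.simple i) = signedConj cs i :=
  cs.lift_apply_simple _ i

theorem signedConjHom_inv_cons (hM : IsSimplyLaced M) (i : B) (ω : List B) (t : W) (ε : ZMod 2) :
    signedConjHom cs hM (cs.wordProd (i :: ω))⁻¹ (t, ε) =
      signedConjHom cs hM (cs.wordProd ω)⁻¹
        (cs.simple i * t * cs.simple i, ε + eqParity t (cs.simple i)) := by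
  rw [cs.wordProd_cons, mul_inv_rev, map_mul, cs.inv_simple, signedConjHom_simple,
    Equiv.Perm.mul_apply, signedConj_apply]

theorem signedConjHom_snd_add (hM : IsSimplyLaced M) (ω : List B) (t : W) (ε : ZMod 2) :
    (signedConjHom cs hM (cs.wordProd ω)⁻¹ (t, ε)).2 =
      (signedConjHom cs hM (cs.wordProd ω)⁻¹ (t, 0)).2 + ε := by
  induction ω generalizing t ε with
  | nil => simp
  | cons i ω ih =>
    rw [signedConjHom_inv_cons, signedConjHom_inv_cons, ih, ih _ (0 + _)]
    ring

theorem exists_deletion_of_sign_ne_zero (hM : IsSimplyLaced M) (ω : List B) (t : W)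
    (h : (signedConjHom cs hM (cs.wordProd ω)⁻¹ (t, 0)).2 ≠ 0) :
    ∃ l₁ x l₂, ω = l₁ ++ x :: l₂ ∧ t * cs.wordProd ω = cs.wordProd (l₁ ++ l₂) := by
  induction ω generalizing t with
  | nil => simp at h
  | cons i ω ih =>
    by_cases ht : t = cs.simple i
    · exact ⟨[], i, ω, rfl, by simp [ht, cs.wordProd_cons]⟩
    · rw [signedConjHom_inv_cons, eqParity, if_neg ht, add_zero] at h
      obtain ⟨l₁, x, l₂, rfl, h2⟩ := ih _ h
      refine ⟨i :: l₁, x, l₂, rfl, ?_⟩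
      rw [List.cons_append, cs.wordProd_cons, cs.wordProd_cons, ← h2]
      simp [mul_assoc]

/-- The exchange property. -/
theorem exists_exchange (hM : IsSimplyLaced M) (ω : List B) (i : B)
    (h : cs.IsLeftDescent (cs.wordProd ω) i) :
    ∃ l₁ x l₂, ω = l₁ ++ x :: l₂ ∧ cs.simple i * cs.wordProd ω = cs.wordProd (l₁ ++ l₂) := by
  apply exists_deletion_of_sign_ne_zero cs hM
  intro h0
  obtain ⟨τ, hτ, hτ'⟩ := cs.exists_isReduced (cs.simple i * cs.wordProd ω)
  have h1 : (signedConjHom cs hM (cs.wordProd τ)⁻¹ (cs.simple i, 0)).2 ≠ 0 := by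
    rw [← hτ', ← cs.wordProd_cons, signedConjHom_inv_cons, signedConjHom_snd_add]
    rw [cs.simple_mul_simple_self, one_mul, h0, eqParity, if_pos rfl]
    decide
  obtain ⟨l₁, x, l₂, rfl, h2⟩ := exists_deletion_of_sign_ne_zero cs hM τ _ h1
  rw [← hτ', cs.simple_mul_simple_cancel_left] at h2
  have h3 := cs.length_wordProd_le (l₁ ++ l₂)
  have h4 := hτ.eq
  rw [← hτ'] at h4
  rw [← h2] at h3
  unfold CoxeterSystem.IsLeftDescent at h
  simp at h3 h4
  omega

end Exchange

/-! ### Words up to commutation -/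

section Words

variable {B : Type*}

/-- The congruence on words generated by swapping letters that are distinct and unrelated. -/
inductive CommEquiv (r : B → B → Prop) : List B → List B → Prop
  | refl (a : List B) : CommEquiv r a a
  | swap (x y : B) (a : List B) : x ≠ y → ¬ r x y → CommEquiv r (x :: y :: a) (y :: x :: a)
  | cons (x : B) {a b : List B} : CommEquiv r a b → CommEquiv r (x :: a) (x :: b)
  | trans {a b c : List B} : CommEquiv r a b → CommEquiv r b c → CommEquiv r a c

theorem CommEquiv.append_left {r : B → B → Prop} {a b : List B} (l : List B)
    (h : CommEquiv r a b) : CommEquiv r (l ++ a) (l ++ b) := by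
  induction l with
  | nil => exact h
  | cons x l ih => exact .cons x ih

theorem CommEquiv.perm {r : B → B → Prop} {a b : List B} (h : CommEquiv r a b) : a.Perm b := by
  induction h with
  | refl a => exact .refl a
  | swap x y a _ _ => exact .swap y x a
  | cons x _ ih => exact ih.cons x
  | trans _ _ ih₁ ih₂ => exact ih₁.trans ih₂

/-- A letter moves past a word all of whose letters commute with it. -/
theorem CommEquiv.cons_append {r : B → B → Prop} (x : B) (l a : List B)
    (h : ∀ y ∈ l, x ≠ y ∧ ¬ r x y) : CommEquiv r (x :: (l ++ a)) (l ++ x :: a) := by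
  induction l with
  | nil => exact .refl _
  | cons y l ih =>
    have hy := h y (by simp)
    exact (CommEquiv.swap x y _ hy.1 hy.2).trans
      (.cons y (ih fun z hz => h z (by simp [hz])))

theorem CommEquiv.symm {r : B → B → Prop} (hr : ∀ x y, r x y → r y x) {a b : List B}
    (h : CommEquiv r a b) : CommEquiv r b a := by
  induction h with
  | refl a => exact .refl a
  | swap x y a h₁ h₂ => exact .swap y x a h₁.symm fun h => h₂ (hr _ _ h)
  | cons x _ ih => exact .cons x ih
  | trans _ _ ih₁ ih₂ => exact ih₂.trans ih₁

variable [DecidableEq B] (r : B → B → Prop) [DecidableRel r]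

/-- The number of letters related to `x` before the first `x` in a word, where the end of the word
counts for two further such letters. -/
def relatedBefore (x : B) : List B → ℕ
  | [] => 2
  | y :: a => if y = x then 0 else if r x y then relatedBefore x a + 1 else relatedBefore x a

/-- Any two occurrences of a letter are separated by at least two letters related to it. -/
def IsSparse : List B → Prop
  | [] => True
  | x :: a => 2 ≤ relatedBefore r x a ∧ IsSparse a

variable {r}

theorem relatedBefore_of_notMem {x : B} {a : List B} (h : x ∉ a) :
    2 ≤ relatedBefore r x a := by
  induction a with
  | nil => simp [relatedBefore]
  | cons y a ih =>
    simp only [List.mem_cons, not_or] at h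
    have := ih h.2
    simp only [relatedBefore, if_neg (Ne.symm h.1)]
    split_ifs <;> omega

theorem relatedBefore_append_of_forall {x : B} (l a : List B) (h : ∀ y ∈ l, x ≠ y ∧ ¬ r x y) :
    relatedBefore r x (l ++ a) = relatedBefore r x a := by
  induction l with
  | nil => rfl
  | cons y l ih =>
    have hy := h y (by simp)
    simp only [List.cons_append, relatedBefore, if_neg (Ne.symm hy.1), if_neg hy.2]
    exact ih fun z hz => h z (by simp [hz])

theorem IsSparse.of_append {l a : List B} (h : IsSparse r (l ++ a)) : IsSparse r a := by
  induction l with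
  | nil => exact h
  | cons x l ih => exact ih h.2

variable (hr : ∀ x y, r x y → r y x)

include hr

theorem CommEquiv.relatedBefore_eq {a b : List B} (h : CommEquiv r a b) (z : B) :
    relatedBefore r z a = relatedBefore r z b := by
  induction h with
  | refl a => rfl
  | swap x y a h₁ h₂ =>
    have h₃ : ¬ r y x := fun h => h₂ (hr _ _ h)
    simp only [relatedBefore]
    by_cases hx : x = z
    · subst hx; simp [h₁.symm, h₂]
    · by_cases hy : y = z
      · subst hy; simp [h₁, h₃]
      · simp only [if_neg hx, if_neg hy]
        split_ifs <;> rfl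
  | cons x _ ih => simp only [relatedBefore, ih]
  | trans _ _ ih₁ ih₂ => exact ih₁.trans ih₂

theorem CommEquiv.isSparse {a b : List B} (h : CommEquiv r a b) (ha : IsSparse r a) :
    IsSparse r b := by
  induction h with
  | refl a => exact ha
  | swap x y a h₁ h₂ =>
    obtain ⟨h₃, h₄, h₅⟩ := ha
    have h₆ : ¬ r y x := fun h => h₂ (hr _ _ h)
    simp only [relatedBefore, if_neg h₁.symm, if_neg h₂] at h₃
    refine ⟨?_, h₃, h₅⟩
    simpa only [relatedBefore, if_neg h₁, if_neg h₆]
  | cons x h ih => exact ⟨h.relatedBefore_eq hr x ▸ ha.1, ih ha.2⟩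
  | trans _ _ ih₁ ih₂ => exact ih₂ (ih₁ ha)

omit hr in
/-- The ways in which a letter can be too close to the next equal one. -/
theorem exists_of_relatedBefore_lt (x : B) (a : List B) (h : relatedBefore r x a < 2) :
    (∃ b c, a = b ++ x :: c ∧ ∀ y ∈ b, x ≠ y ∧ ¬ r x y) ∨
      ∃ b y b' c, a = b ++ y :: (b' ++ x :: c) ∧ r x y ∧ (∀ y ∈ b, x ≠ y ∧ ¬ r x y) ∧
        ∀ y ∈ b', x ≠ y ∧ ¬ r x y := by
  have key : ∀ a : List B, relatedBefore r x a < 1 →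
      ∃ b c, a = b ++ x :: c ∧ ∀ y ∈ b, x ≠ y ∧ ¬ r x y := by
    intro a
    induction a with
    | nil => simp [relatedBefore]
    | cons y a ih =>
      intro h
      by_cases hy : y = x
      · exact ⟨[], a, by simp [hy], by simp⟩
      · simp only [relatedBefore, if_neg hy] at h
        by_cases hxy : r x y
        · simp [hxy] at h
        · rw [if_neg hxy] at h
          obtain ⟨b, c, rfl, hb⟩ := ih h
          exact ⟨y :: b, c, rfl, by simpa using ⟨⟨Ne.symm hy, hxy⟩, hb⟩⟩
  induction a with
  | nil => simp [relatedBefore] at h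
  | cons y a ih =>
    by_cases hy : y = x
    · exact .inl ⟨[], a, by simp [hy], by simp⟩
    · simp only [relatedBefore, if_neg hy] at h
      by_cases hxy : r x y
      · rw [if_pos hxy] at h
        obtain ⟨b, c, rfl, hb⟩ := key a (by omega)
        exact .inr ⟨[], y, b, c, rfl, hxy, by simp, hb⟩
      · rw [if_neg hxy] at h
        rcases ih h with ⟨b, c, rfl, hb⟩ | ⟨b, z, b', c, rfl, hz, hb, hb'⟩
        · exact .inl ⟨y :: b, c, rfl, by simpa using ⟨⟨Ne.symm hy, hxy⟩, hb⟩⟩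
        · exact .inr ⟨y :: b, z, b', c, rfl, hz, by simpa using ⟨⟨Ne.symm hy, hxy⟩, hb⟩, hb'⟩

end Words

/-! ### Fully commutative elements of simply laced Coxeter groups -/

section FullyCommutative

variable {B W : Type*} [Group W] {M : CoxeterMatrix B} (cs : CoxeterSystem M W)

/-- Adjacency by a simple edge in the Coxeter graph. -/
def CoxeterMatrix.Linked (M : CoxeterMatrix B) (i j : B) : Prop := M i j = 3

instance (M : CoxeterMatrix B) : DecidableRel M.Linked := fun i j => by
  unfold CoxeterMatrix.Linked; infer_instance

theorem CoxeterMatrix.Linked.symm {i j : B} (h : M.Linked i j) : M.Linked j i :=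
  (M.symmetric i j).symm.trans h

theorem CommEquiv.wordProd_eq (hM : IsSimplyLaced M) {ω ω' : List B}
    (h : CommEquiv M.Linked ω ω') : cs.wordProd ω = cs.wordProd ω' := by
  induction h with
  | refl => rfl
  | swap x y a h₁ h₂ =>
    have := simple_commute cs ((hM x y h₁).resolve_right h₂)
    simp only [cs.wordProd_cons, ← mul_assoc, this]
  | cons x _ ih => simp only [cs.wordProd_cons, ih]
  | trans _ _ ih₁ ih₂ => exact ih₁.trans ih₂

theorem CommEquiv.reflTransGen (hM : IsSimplyLaced M) {ω ω' : List B}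
    (h : CommEquiv M.Linked ω ω') :
    Relation.ReflTransGen (CommutationMoveRel M) ω ω' := by
  induction h with
  | refl => exact .refl
  | swap x y a h₁ h₂ => exact .single ⟨x, y, [], a, (hM x y h₁).resolve_right h₂, rfl, rfl⟩
  | cons x _ ih =>
    refine ih.lift (List.cons x) ?_
    rintro _ _ ⟨i, j, l₁, l₂, h, rfl, rfl⟩
    exact ⟨i, j, x :: l₁, l₂, h, rfl, rfl⟩
  | trans _ _ ih₁ ih₂ => exact ih₁.trans ih₂

theorem perm_of_reflTransGen_commutationMoveRel {ω ω' : List B}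
    (h : Relation.ReflTransGen (CommutationMoveRel M) ω ω') : ω.Perm ω' := by
  induction h with
  | refl => exact .refl _
  | tail _ h ih =>
    obtain ⟨i, j, l₁, l₂, -, rfl, rfl⟩ := h
    exact ih.trans (((List.Perm.swap j i []).append_left l₁).append_right l₂)

/-- A sparse word is reduced, and all reduced words for its product are equivalent to it. -/
theorem IsSparse.isReduced_and_commEquiv [DecidableEq B] (hM : IsSimplyLaced M)
    (hinj : Function.Injective cs.simple)
    (hnc : ∀ i j, M i j = 3 → cs.simple i * cs.simple j ≠ cs.simple j * cs.simple i)
    {ω : List B} (hω : IsSparse M.Linked ω) :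
    cs.IsReduced ω ∧ ∀ ω', cs.IsReduced ω' → cs.wordProd ω' = cs.wordProd ω →
      CommEquiv M.Linked ω ω' := by
  have hsymm : ∀ x y, M.Linked x y → M.Linked y x := fun _ _ h => h.symm
  induction h : ω.length using Nat.strong_induction_on generalizing ω with
  | _ n ih =>
  subst h
  rcases ω with _ | ⟨x, a⟩
  · refine ⟨by simp [CoxeterSystem.IsReduced], fun ω' h₁ h₂ => ?_⟩
    have := h₁.eq
    rw [h₂] at this
    simp at this
    rw [List.eq_nil_of_length_eq_zero this.symm]
    exact .refl _
  obtain ⟨ha₁, ha₂⟩ := ih a.length (by simp) hω.2 rfl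
  have hred : cs.IsReduced (x :: a) := by
    have hnd : ¬ cs.IsLeftDescent (cs.wordProd a) x := by
      intro hd
      obtain ⟨l₁, z, l₂, rfl, h₂⟩ := exists_exchange cs hM a x hd
      have h₃ : cs.wordProd (x :: (l₁ ++ l₂)) = cs.wordProd (l₁ ++ z :: l₂) := by
        rw [cs.wordProd_cons, ← h₂, cs.simple_mul_simple_cancel_left]
      have h₄ : cs.IsReduced (x :: (l₁ ++ l₂)) := by
        rw [CoxeterSystem.IsReduced, h₃, ha₁.eq]; simp; omega
      have h₅ := ((ha₂ _ h₄ h₃).cons x).isSparse hsymm hω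
      simp [IsSparse, relatedBefore] at h₅
    rw [cs.not_isLeftDescent_iff] at hnd
    rw [CoxeterSystem.IsReduced, cs.wordProd_cons, hnd, ha₁.eq, List.length_cons]
  refine ⟨hred, fun ω' hω' hprod => ?_⟩
  rcases ω' with _ | ⟨y, c⟩
  · have := hred.eq
    rw [← hprod] at this
    simp at this
  have hc : cs.IsReduced c := by simpa using hω'.drop 1
  have hlen : c.length = a.length := by
    have h₁ := hω'.eq
    have h₂ := hred.eq
    rw [hprod, h₂] at h₁
    simpa using h₁.symm
  by_cases hxy : x = y
  · subst hxy
    rw [cs.wordProd_cons, cs.wordProd_cons, mul_right_inj] at hprod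
    exact .cons x (ha₂ c hc hprod)
  -- the letter `y` is a left descent of the product
  have hyd : cs.IsLeftDescent (cs.wordProd (x :: a)) y := by
    rw [CoxeterSystem.IsLeftDescent, ← hprod, cs.wordProd_cons,
      cs.simple_mul_simple_cancel_left, hc.eq, ← cs.wordProd_cons, hω'.eq]
    simp
  obtain ⟨l₁, z, l₂, h₁, h₂⟩ := exists_exchange cs hM _ y hyd
  have hprod' : cs.wordProd c = cs.simple y * cs.wordProd (x :: a) := by
    rw [← hprod, cs.wordProd_cons, cs.simple_mul_simple_cancel_left]
  rcases l₁ with _ | ⟨x', l₁⟩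
  · simp only [List.nil_append, List.cons.injEq] at h₁ h₂
    obtain ⟨rfl, rfl⟩ := h₁
    rw [cs.wordProd_cons, ← mul_assoc, mul_eq_right] at h₂
    have := eq_inv_of_mul_eq_one_right h₂
    rw [cs.inv_simple] at this
    exact absurd (hinj this) hxy
  obtain ⟨rfl, rfl⟩ : x = x' ∧ a = l₁ ++ z :: l₂ := by simpa using h₁
  have hlen' : c.length = (l₁ ++ l₂).length + 1 := by rw [hlen]; simp [add_assoc]
  rw [List.cons_append] at h₂
  have hw : cs.wordProd (x :: (l₁ ++ z :: l₂)) = cs.wordProd (y :: x :: (l₁ ++ l₂)) := by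
    rw [cs.wordProd_cons y, ← h₂, cs.simple_mul_simple_cancel_left]
  have hxa : cs.wordProd (l₁ ++ z :: l₂) = cs.simple x * cs.wordProd (y :: x :: (l₁ ++ l₂)) := by
    rw [← hw, cs.wordProd_cons, cs.simple_mul_simple_cancel_left]
  rcases hM x y hxy with hxy2 | hxy3
  · have hlink : ¬ M.Linked x y := by rw [CoxeterMatrix.Linked, hxy2]; decide
    have h₃ : cs.wordProd (y :: (l₁ ++ l₂)) = cs.wordProd (l₁ ++ z :: l₂) := by
      rw [hxa, cs.wordProd_cons, cs.wordProd_cons, cs.wordProd_cons, ← mul_assoc,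
        ← mul_assoc, simple_commute cs hxy2]
      simp [mul_assoc]
    have h₄ : cs.IsReduced (y :: (l₁ ++ l₂)) := by
      rw [CoxeterSystem.IsReduced, h₃, ha₁.eq, ← hlen, hlen', List.length_cons]
    have h₅ := (ha₂ _ h₄ h₃).cons x |>.trans (.swap x y _ hxy hlink)
    have h₆ := (ih _ (by simp) (h₅.isSparse hsymm hω).2 rfl).2 c hc
      (by rw [hprod', h₂])
    exact h₅.trans (h₆.cons y)
  · have hlw : cs.length (cs.wordProd (y :: x :: (l₁ ++ l₂))) = (l₁ ++ l₂).length + 2 := by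
      rw [← hw, hred.eq, List.length_cons, ← hlen, hlen']
    have hxd : cs.IsLeftDescent (cs.wordProd (y :: x :: (l₁ ++ l₂))) x := by
      rw [CoxeterSystem.IsLeftDescent, ← hxa, ha₁.eq, hlw, ← hlen, hlen']
      omega
    obtain ⟨l₃, z', l₄, h₃, h₄⟩ := exists_exchange cs hM _ x hxd
    rcases l₃ with _ | ⟨y', l₃⟩
    · simp only [List.nil_append, List.cons.injEq] at h₃ h₄
      obtain ⟨rfl, rfl⟩ := h₃
      rw [cs.wordProd_cons x, mul_right_inj] at h₄
      have := cs.length_wordProd_le (l₁ ++ l₂)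
      rw [← h₄, hlw] at this
      omega
    rcases l₃ with _ | ⟨x', l₃⟩
    · simp only [List.nil_append, List.cons_append, List.cons.injEq] at h₃ h₄
      obtain ⟨rfl, rfl, rfl⟩ := h₃
      rw [cs.wordProd_cons, cs.wordProd_cons, cs.wordProd_cons, ← mul_assoc, ← mul_assoc,
        mul_left_inj] at h₄
      refine absurd ?_ (hnc x y hxy3)
      nth_rewrite 2 [← h₄]
      simp
    · simp only [List.cons_append, List.cons.injEq] at h₃ h₄
      obtain ⟨rfl, rfl, h₃⟩ := h₃
      have hlen₃ := congrArg List.length h₃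
      have h₅ : cs.IsReduced (y :: x :: (l₃ ++ l₄)) := by
        rw [CoxeterSystem.IsReduced, ← h₄, ← hxa, ha₁.eq, ← hlen, hlen', hlen₃]
        simp [add_assoc]
      have h₆ := ((ha₂ _ h₅ (by rw [hxa, h₄])).cons x).isSparse hsymm hω
      have h₇ : M.Linked x y := hxy3
      simp [IsSparse, relatedBefore, Ne.symm hxy, h₇] at h₆

/-- A reduced word of a fully commutative element is sparse. -/
theorem IsFullyCommutative.isSparse [DecidableEq B] (hM : IsSimplyLaced M)
    {ω : List B} (hfc : IsFullyCommutative cs (cs.wordProd ω)) (hω : cs.IsReduced ω) :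
    IsSparse M.Linked ω := by
  by_contra hns
  obtain ⟨l, x, a, rfl, hx⟩ : ∃ l x a, ω = l ++ x :: a ∧ relatedBefore M.Linked x a < 2 := by
    clear hfc hω
    induction ω with
    | nil => simp [IsSparse] at hns
    | cons y ω ih =>
      by_cases h : 2 ≤ relatedBefore M.Linked y ω
      · obtain ⟨l, x, a, rfl, hx⟩ := ih fun h' => hns ⟨h, h'⟩
        exact ⟨y :: l, x, a, rfl, hx⟩
      · exact ⟨[], y, ω, rfl, by omega⟩
  rcases exists_of_relatedBefore_lt x a hx with ⟨b, c, rfl, hb⟩ | ⟨b, y, b', c, rfl, hy, hb, hb'⟩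
  · have h₁ := ((CommEquiv.cons_append x b (x :: c) hb).append_left l).wordProd_eq cs hM
    have h₂ : cs.wordProd (l ++ (b ++ x :: x :: c)) = cs.wordProd (l ++ (b ++ c)) := by
      simp [cs.wordProd_append, cs.wordProd_cons]
    have h₃ := cs.length_wordProd_le (l ++ (b ++ c))
    rw [← h₂, ← h₁, hω.eq] at h₃
    simp at h₃
  · have h₁ := ((CommEquiv.cons_append x b (y :: (b' ++ x :: c)) hb).append_left l).trans
      (((((CommEquiv.cons_append x b' c hb').symm fun _ _ h => h.symm).cons y).cons x
        |>.append_left b).append_left l)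
    have h₂ : cs.wordProd (l ++ (b ++ x :: y :: x :: (b' ++ c))) =
        cs.wordProd (l ++ (b ++ y :: x :: y :: (b' ++ c))) := by
      have := simple_braid cs hy
      simp only [cs.wordProd_append, cs.wordProd_cons, ← mul_assoc] at this ⊢
      simp only [mul_assoc _ _ (cs.simple x), mul_assoc _ _ (cs.simple y)] at this ⊢
      rw [this]
    have h₃ := h₁.wordProd_eq cs hM
    have h₄ : cs.IsReduced (l ++ (b ++ y :: x :: y :: (b' ++ c))) := by
      rw [CoxeterSystem.IsReduced, ← h₂, ← h₃, hω.eq]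
      simp; omega
    have h₅ := perm_of_reflTransGen_commutationMoveRel (hfc _ _ hω h₄ rfl (by rw [h₃, h₂]))
    have h₆ := (h₁.perm.symm.trans h₅).count_eq x
    have hxy : y ≠ x := by
      rintro rfl
      rw [CoxeterMatrix.Linked, M.diagonal] at hy
      omega
    simp [hxy] at h₆

end FullyCommutative

/-! ### Sparse words of type `D` -/

section TypeD

/-- Adjacency in the infinite Coxeter graph of type `D`. -/
def dAdj (i j : ℕ) : Prop :=
  (i = 0 ∧ j = 2) ∨ (j = 0 ∧ i = 2) ∨ (1 ≤ i ∧ 1 ≤ j ∧ (i + 1 = j ∨ j + 1 = i))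

instance : DecidableRel dAdj := fun i j => by unfold dAdj; infer_instance

theorem dAdj_symm (i j : ℕ) (h : dAdj i j) : dAdj j i := by unfold dAdj at *; tauto

theorem relatedBefore_self (x : ℕ) (a : List ℕ) : relatedBefore dAdj x (x :: a) = 0 := by
  simp [relatedBefore]

theorem relatedBefore_cons_of_adj {x y : ℕ} (a : List ℕ) (h : dAdj x y) :
    relatedBefore dAdj x (y :: a) = relatedBefore dAdj x a + 1 := by
  have : y ≠ x := by rintro rfl; unfold dAdj at h; omega
  simp [relatedBefore, this, h]

theorem relatedBefore_cons_of_not_adj {x y : ℕ} (a : List ℕ) (h : ¬ dAdj x y) (hne : y ≠ x) :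
    relatedBefore dAdj x (y :: a) = relatedBefore dAdj x a := by
  simp [relatedBefore, hne, h]

theorem relatedBefore_range'_le {x m len : ℕ} (a : List ℕ) (hm : 1 ≤ m) (h₁ : m ≤ x)
    (h₂ : x < m + len) : relatedBefore dAdj x (List.range' m len ++ a) ≤ 1 := by
  induction len generalizing m with
  | zero => omega
  | succ len ih =>
    rw [List.range'_succ, List.cons_append]
    rcases Nat.lt_trichotomy x (m + 1) with h | h | h
    · obtain rfl : x = m := by omega
      simp [relatedBefore_self]
    · subst h
      rw [relatedBefore_cons_of_adj _ (by unfold dAdj; omega)]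
      obtain ⟨len, rfl⟩ := Nat.exists_eq_succ_of_ne_zero (show len ≠ 0 by omega)
      rw [List.range'_succ, List.cons_append, relatedBefore_self]
    · rw [relatedBefore_cons_of_not_adj _ (by unfold dAdj; omega) (by omega)]
      exact ih (by omega) (by omega) (by omega)

theorem one_le_relatedBefore_range' {x m len : ℕ} {a : List ℕ} (hm : 1 ≤ m) (h : m < x)
    (ha : 1 ≤ relatedBefore dAdj x a) :
    1 ≤ relatedBefore dAdj x (List.range' m len ++ a) := by
  induction len generalizing m with
  | zero => simpa using ha
  | succ len ih =>
    rw [List.range'_succ, List.cons_append]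
    by_cases h' : x = m + 1
    · rw [relatedBefore_cons_of_adj _ (by unfold dAdj; omega)]
      omega
    · rw [relatedBefore_cons_of_not_adj _ (by unfold dAdj; omega) (by omega)]
      exact ih (by omega) (by omega)

theorem relatedBefore_range'_succ {x len : ℕ} (a : List ℕ) (hx : 1 ≤ x) :
    relatedBefore dAdj x (List.range' (x + 1) (len + 1) ++ a) = relatedBefore dAdj x a + 1 := by
  rw [List.range'_succ, List.cons_append, relatedBefore_cons_of_adj _ (by unfold dAdj; omega),
    relatedBefore_append_of_forall]
  intro y hy
  rw [List.mem_range'_1] at hy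
  unfold dAdj
  omega

theorem relatedBefore_zero_range' {len : ℕ} (a : List ℕ) :
    relatedBefore dAdj 0 (List.range' 2 (len + 1) ++ a) = relatedBefore dAdj 0 a + 1 := by
  rw [List.range'_succ, List.cons_append, relatedBefore_cons_of_adj _ (by unfold dAdj; omega),
    relatedBefore_append_of_forall]
  intro y hy
  rw [List.mem_range'_1] at hy
  unfold dAdj
  omega

theorem not_isSparse_range'_append {x m len : ℕ} {a : List ℕ} (hx : 1 ≤ x) (h₁ : m ≤ x)
    (h₂ : x + 1 < m + len) (ha : relatedBefore dAdj x a = 0) :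
    ¬ IsSparse dAdj (List.range' m len ++ a) := by
  intro h
  induction len generalizing m with
  | zero => omega
  | succ len ih =>
    rw [List.range'_succ, List.cons_append] at h
    by_cases hxm : x = m
    · subst hxm
      obtain ⟨len, rfl⟩ := Nat.exists_eq_succ_of_ne_zero (show len ≠ 0 by omega)
      have := h.1
      rw [relatedBefore_range'_succ _ hx] at this
      omega
    · exact ih (by omega) (by omega) h.2

theorem isSparse_range'_append {m len : ℕ} {a : List ℕ} (hm : 1 ≤ m) (ha : IsSparse dAdj a)
    (h₁ : ∀ x, m ≤ x → 1 ≤ relatedBefore dAdj x a)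
    (h₂ : ∀ x, m + len = x + 1 → 2 ≤ relatedBefore dAdj x a) :
    IsSparse dAdj (List.range' m len ++ a) := by
  induction len generalizing m with
  | zero => simpa using ha
  | succ len ih =>
    rw [List.range'_succ, List.cons_append]
    refine ⟨?_, ih (by omega) (fun x hx => h₁ x (by omega)) fun x hx => h₂ x (by omega)⟩
    rcases len with _ | len
    · simpa using h₂ m rfl
    · rw [relatedBefore_range'_succ _ hm]
      have := h₁ m le_rfl
      omega

theorem one_cons_range' (n : ℕ) : 1 :: List.range' 2 n = List.range' 1 (n + 1) := by
  rw [List.range'_succ]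

/-- The word `s_{j+1} ⋯ s₂ s₁̄ s₁ s₂ ⋯ s_N`. -/
def forkRow (N : ℕ) : ℕ → List ℕ
  | 0 => 0 :: 1 :: List.range' 2 (N - 1)
  | j + 1 => (j + 2) :: forkRow N j

theorem forkRow_eq_append (N j : ℕ) :
    ∃ l, forkRow N j = l ++ 0 :: 1 :: List.range' 2 (N - 1) := by
  induction j with
  | zero => exact ⟨[], rfl⟩
  | succ j ih =>
    obtain ⟨l, hl⟩ := ih
    exact ⟨(j + 2) :: l, by rw [forkRow, hl]; rfl⟩

theorem le_of_mem_forkRow {N j x : ℕ} (hj : j < N) (hx : x ∈ forkRow N j) : x ≤ N := by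
  induction j with
  | zero =>
    simp only [forkRow, List.mem_cons, List.mem_range'_1] at hx
    omega
  | succ j ih =>
    rw [forkRow, List.mem_cons] at hx
    rcases hx with rfl | hx
    · omega
    · exact ih (by omega) hx

theorem relatedBefore_forkRow_le {N j x : ℕ} (a : List ℕ) (h : x ≤ j + 1 ∨ j + 3 ≤ x ∧ x ≤ N) :
    relatedBefore dAdj x (forkRow N j ++ a) ≤ 1 := by
  induction j with
  | zero =>
    rw [forkRow, List.cons_append, List.cons_append]
    rcases h with h | h
    · interval_cases x <;> simp [relatedBefore, dAdj]
    · rw [relatedBefore_cons_of_not_adj _ (by unfold dAdj; omega) (by omega),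
        relatedBefore_cons_of_not_adj _ (by unfold dAdj; omega) (by omega)]
      exact relatedBefore_range'_le a (by omega) (by omega) (by omega)
  | succ j ih =>
    rw [forkRow, List.cons_append]
    by_cases hx : x = j + 2
    · subst hx
      simp [relatedBefore_self]
    by_cases hadj : dAdj x (j + 2)
    · rw [relatedBefore_cons_of_adj _ hadj]
      rcases j with _ | j
      · have : x = 0 ∨ x = 1 := by unfold dAdj at hadj; omega
        rcases this with rfl | rfl <;> simp [forkRow, relatedBefore, dAdj]
      · obtain rfl : x = j + 2 := by unfold dAdj at hadj; omega
        rw [forkRow, List.cons_append, relatedBefore_self]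
    · rw [relatedBefore_cons_of_not_adj _ hadj (Ne.symm hx)]
      exact ih (by unfold dAdj at hadj; omega)

theorem one_le_relatedBefore_forkRow {N j x : ℕ} (h : j + 2 ≤ x) :
    1 ≤ relatedBefore dAdj x (forkRow N j) := by
  induction j with
  | zero =>
    rw [forkRow]
    by_cases hx : x = 2
    · subst hx
      rw [relatedBefore_cons_of_adj _ (by unfold dAdj; omega)]
      omega
    · rw [relatedBefore_cons_of_not_adj _ (by unfold dAdj; omega) (by omega),
        relatedBefore_cons_of_not_adj _ (by unfold dAdj; omega) (by omega)]
      simpa using one_le_relatedBefore_range' (x := x) (len := N - 1) (a := []) (m := 2)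
        (by omega) (by omega) (by simp [relatedBefore])
  | succ j ih =>
    have := ih (by omega)
    rw [forkRow, relatedBefore]
    split_ifs <;> omega

theorem isSparse_of_nodup {a : List ℕ} (h : a.Nodup) : IsSparse dAdj a := by
  induction a with
  | nil => trivial
  | cons x a ih =>
    rw [List.nodup_cons] at h
    exact ⟨relatedBefore_of_notMem h.1, ih h.2⟩

theorem isSparse_forkRow (N j : ℕ) : IsSparse dAdj (forkRow N j) := by
  induction j with
  | zero =>
    apply isSparse_of_nodup
    simp [forkRow, List.mem_range'_1, List.nodup_range']
  | succ j ih =>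
    refine ⟨?_, ih⟩
    rcases j with _ | j
    · rw [forkRow, relatedBefore_cons_of_adj _ (by unfold dAdj; omega),
        relatedBefore_cons_of_adj _ (by unfold dAdj; omega)]
      omega
    · have := one_le_relatedBefore_forkRow (N := N) (show j + 2 ≤ j + 1 + 2 by omega)
      rw [forkRow, relatedBefore_cons_of_adj _ (by unfold dAdj; omega)]
      omega

/-- The possible forms of the initial part of a sparse word that involves the letter `N`. -/
inductive IsRow (N : ℕ) : List ℕ → Prop
  | nil : IsRow N []
  | asc (m : ℕ) : 2 ≤ m → m ≤ N → IsRow N (List.range' m (N + 1 - m))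
  | zero : IsRow N (0 :: List.range' 2 (N - 1))
  | one : IsRow N (1 :: List.range' 2 (N - 1))
  | fork (j : ℕ) : j < N → IsRow N (forkRow N j)

theorem exists_isRow {N : ℕ} (hN : 2 ≤ N) {ω : List ℕ} (hω : IsSparse dAdj ω)
    (hle : ∀ x ∈ ω, x ≤ N) :
    ∃ l a, IsRow N l ∧ (∀ x ∈ a, x < N) ∧ CommEquiv dAdj ω (l ++ a) := by
  induction ω with
  | nil => exact ⟨[], [], .nil, by simp, .refl _⟩
  | cons x ω ih =>
    obtain ⟨l, a, hl, ha, hequiv⟩ := ih hω.2 fun y hy => hle y (by simp [hy])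
    have hequiv' := hequiv.cons x
    have hx := hle x (by simp)
    have hrel := (hequiv'.isSparse dAdj_symm hω).1
    cases hl with
    | nil =>
      by_cases hxN : x = N
      · subst hxN
        exact ⟨_, a, .asc x hN le_rfl, ha, by simpa using hequiv'⟩
      · refine ⟨[], x :: a, .nil, ?_, hequiv'⟩
        simp only [List.mem_cons, forall_eq_or_imp]
        exact ⟨by omega, ha⟩
    | asc m hm hmN =>
      by_cases h₁ : m ≤ x
      · have := relatedBefore_range'_le a (len := N + 1 - m) (by omega) h₁ (by omega)
        omega
      by_cases h₂ : x + 1 = m ∧ 3 ≤ m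
      · obtain ⟨rfl, h₂⟩ := h₂
        refine ⟨_, a, .asc x (by omega) hx, ha, ?_⟩
        rwa [show N + 1 - x = N + 1 - (x + 1) + 1 by omega, List.range'_succ]
      by_cases h₃ : m = 2
      · subst h₃
        obtain rfl | rfl : x = 0 ∨ x = 1 := by omega
        · exact ⟨_, a, .zero, ha, hequiv'⟩
        · exact ⟨_, a, .one, ha, hequiv'⟩
      · refine ⟨_, x :: a, .asc m hm hmN, ?_, hequiv'.trans (.cons_append x _ _ ?_)⟩
        · simp only [List.mem_cons, forall_eq_or_imp]
          exact ⟨by omega, ha⟩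
        · intro y hy
          rw [List.mem_range'_1] at hy
          unfold dAdj
          omega
    | zero =>
      rw [List.cons_append] at hrel hequiv'
      rcases Nat.lt_or_ge 2 x with h | h
      · rw [relatedBefore_cons_of_not_adj _ (by unfold dAdj; omega) (by omega)] at hrel
        have := relatedBefore_range'_le (x := x) a (len := N - 1) (m := 2) (by omega) (by omega)
          (by omega)
        omega
      · interval_cases x
        · rw [relatedBefore_self] at hrel
          omega
        · exact ⟨_, a, .fork 0 (by omega), ha,
            hequiv'.trans (.swap 1 0 _ (by omega) (by unfold dAdj; omega))⟩
        · rw [relatedBefore_cons_of_adj _ (by unfold dAdj; omega)] at hrel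
          obtain ⟨N, rfl⟩ := Nat.exists_eq_add_of_le hN
          rw [show 2 + N - 1 = N + 1 by omega, List.range'_succ, List.cons_append,
            relatedBefore_self] at hrel
          omega
    | one =>
      rcases Nat.eq_zero_or_pos x with rfl | h
      · exact ⟨_, a, .fork 0 (by omega), ha, hequiv'⟩
      · rw [one_cons_range'] at hrel
        have := relatedBefore_range'_le (x := x) a (len := N - 1 + 1) (m := 1) (by omega) h
          (by omega)
        omega
    | fork j hj =>
      by_cases h : x = j + 2
      · subst h
        exact ⟨_, a, .fork (j + 1) (by omega), ha, hequiv'⟩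
      · have := relatedBefore_forkRow_le (N := N) (j := j) (x := x) a (by omega)
        omega

/-- The letters `0` and `1` occur without a letter `2` in between. -/
def HasFork (ω : List ℕ) : Prop :=
  [0, 1] <:+: ω.filter (· ≤ 2) ∨ [1, 0] <:+: ω.filter (· ≤ 2)

theorem HasFork.cons (x : ℕ) {a : List ℕ} (h : HasFork a) : HasFork (x :: a) := by
  unfold HasFork at *
  rw [List.filter_cons]
  split_ifs
  · exact h.imp List.infix_cons List.infix_cons
  · exact h

theorem CommEquiv.hasFork {a b : List ℕ} (h : CommEquiv dAdj a b) (ha : HasFork a) :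
    HasFork b := by
  have key : a.filter (· ≤ 2) = b.filter (· ≤ 2) ∨ HasFork a ∧ HasFork b := by
    clear ha
    induction h with
    | refl => exact .inl rfl
    | swap x y a hne hadj =>
      by_cases hx : x ≤ 2 <;> by_cases hy : y ≤ 2
      · right
        have : x = 0 ∧ y = 1 ∨ x = 1 ∧ y = 0 := by unfold dAdj at hadj; omega
        rcases this with ⟨rfl, rfl⟩ | ⟨rfl, rfl⟩ <;>
        simp [HasFork, List.infix_cons_iff]
      all_goals simp [hx, hy]
    | cons x _ ih =>
      rcases ih with h | h
      · left; simp only [List.filter_cons, h]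
      · exact .inr ⟨h.1.cons x, h.2.cons x⟩
    | trans _ _ ih₁ ih₂ =>
      unfold HasFork at *
      rcases ih₁ with h₁ | h₁ <;> rcases ih₂ with h₂ | h₂
      · exact .inl (h₁.trans h₂)
      · right; rw [h₁]; exact h₂
      · right; rw [← h₂]; exact h₁
      · exact .inr ⟨h₁.1, h₂.2⟩
  rcases key with h | h
  · unfold HasFork at *
    rwa [← h]
  · exact h.2

theorem HasFork.of_append {l a : List ℕ} (hl : ∀ x ∈ l, 2 ≤ x) (h : HasFork (l ++ a)) :
    HasFork a := by
  induction l with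
  | nil => exact h
  | cons x l ih =>
    apply ih fun y hy => hl y (by simp [hy])
    have hx := hl x (by simp)
    unfold HasFork at *
    rw [List.cons_append, List.filter_cons] at h
    split_ifs at h with h'
    · obtain rfl : x = 2 := by simp at h'; omega
      simpa [List.infix_cons_iff] using h
    · exact h

theorem HasFork.of_cons_two {x : ℕ} {a : List ℕ} (h : HasFork (x :: 2 :: a)) : HasFork a := by
  unfold HasFork at *
  by_cases hx : x ≤ 2
  · simpa [hx, List.infix_cons_iff] using h
  · simpa [hx, List.infix_cons_iff] using h

/-- Representatives of the commutation classes of sparse words in the letters `0, …, N` in which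
`0` and `1` occur next to each other; the second argument records the initial letter. -/
def normalWords : ℕ → ℕ → Finset (List ℕ)
  | 0, _ => ∅
  | N + 1, j =>
    if j ≤ N then
      insert (forkRow (N + 1) j) (normalWords N j ∪
        (Finset.range j).biUnion fun i =>
          (normalWords N i).image (List.range' (j + 1) (N + 1 - j) ++ ·))
    else ∅

theorem mem_normalWords_succ {N j : ℕ} {ν : List ℕ} :
    ν ∈ normalWords (N + 1) j ↔ j ≤ N ∧ (ν = forkRow (N + 1) j ∨ ν ∈ normalWords N j ∨
      ∃ i < j, ∃ μ ∈ normalWords N i, List.range' (j + 1) (N + 1 - j) ++ μ = ν) := by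
  rw [normalWords]
  split_ifs with h <;> simp [h]

theorem relatedBefore_normalWords {N j : ℕ} {ν : List ℕ} (h : ν ∈ normalWords N j) :
    j < N ∧ relatedBefore dAdj (j + 1) ν = 0 ∧ (j = 0 → relatedBefore dAdj 0 ν = 0) := by
  induction N with
  | zero => simp [normalWords] at h
  | succ N ih =>
    rw [mem_normalWords_succ] at h
    obtain ⟨hj, rfl | h | ⟨i, hi, μ, hμ, rfl⟩⟩ := h
    · rcases j with _ | j <;> simp [forkRow, relatedBefore, dAdj]
      omega
    · have := ih h
      exact ⟨by omega, this.2⟩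
    · refine ⟨by omega, ?_, by omega⟩
      rw [show N + 1 - j = N - j + 1 by omega, List.range'_succ, List.cons_append,
        relatedBefore_self]

theorem normalWords_spec {N j : ℕ} {ν : List ℕ} (h : ν ∈ normalWords N j) :
    (∀ x ∈ ν, x ≤ N) ∧ [0, 1] <:+: ν ∧ IsSparse dAdj ν ∧
      ∀ x, j + 2 ≤ x → 1 ≤ relatedBefore dAdj x ν := by
  induction N generalizing j ν with
  | zero => simp [normalWords] at h
  | succ N ih =>
    rw [mem_normalWords_succ] at h
    obtain ⟨hj, rfl | h | ⟨i, hi, μ, hμ, rfl⟩⟩ := h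
    · refine ⟨fun x hx => le_of_mem_forkRow (by omega) hx, ?_, isSparse_forkRow _ _,
        fun x hx => one_le_relatedBefore_forkRow hx⟩
      obtain ⟨l, hl⟩ := forkRow_eq_append (N + 1) j
      exact ⟨l, List.range' 2 (N + 1 - 1), by simp [hl]⟩
    · obtain ⟨h₁, h₂⟩ := ih h
      exact ⟨fun x hx => (h₁ x hx).trans (by omega), h₂⟩
    · obtain ⟨h₁, h₂, h₃, h₄⟩ := ih hμ
      refine ⟨?_, ?_, ?_, ?_⟩
      · intro x hx
        rw [List.mem_append, List.mem_range'_1] at hx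
        rcases hx with hx | hx
        · omega
        · exact (h₁ x hx).trans (by omega)
      · exact h₂.trans (List.suffix_append _ _).isInfix
      · refine isSparse_range'_append (by omega) h₃ (fun x hx => h₄ x (by omega)) fun x hx => ?_
        exact relatedBefore_of_notMem fun hx' => by have := h₁ x hx'; omega
      · exact fun x hx => one_le_relatedBefore_range' (by omega) (by omega) (h₄ x (by omega))

theorem exists_normalWord {N : ℕ} {ω : List ℕ} (hω : IsSparse dAdj ω)
    (hle : ∀ x ∈ ω, x ≤ N) (hfork : HasFork ω) :
    ∃ j, ∃ ν ∈ normalWords N j, CommEquiv dAdj ω ν := by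
  induction N generalizing ω with
  | zero =>
    have h : ∀ c ∈ ω.filter (· ≤ 2), c ≤ 0 := fun c hc => hle c (List.mem_filter.1 hc).1
    rcases hfork with hf | hf
    · exact absurd (h 1 (hf.subset (by simp))) (by omega)
    · exact absurd (h 1 (hf.subset (by simp))) (by omega)
  | succ N ih =>
    rcases Nat.eq_zero_or_pos N with rfl | hN
    · have hn : [0, 1] ∈ normalWords 1 0 := by
        rw [mem_normalWords_succ]; exact ⟨le_rfl, .inl rfl⟩
      have h01 : ∀ x ∈ ω, x = 0 ∨ x = 1 := fun x hx => by have := hle x hx; omega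
      refine ⟨0, _, hn, ?_⟩
      rcases ω with _ | ⟨x, _ | ⟨y, _ | ⟨z, a⟩⟩⟩
      · simp [HasFork] at hfork
      · rcases h01 x (by simp) with rfl | rfl <;> simp [HasFork, List.infix_cons_iff] at hfork
      · rcases h01 x (by simp) with rfl | rfl <;> rcases h01 y (by simp) with rfl | rfl
        · simp [IsSparse, relatedBefore] at hω
        · exact .refl _
        · exact .swap 1 0 [] (by omega) (by unfold dAdj; omega)
        · simp [IsSparse, relatedBefore] at hω
      · rcases h01 x (by simp) with rfl | rfl <;> rcases h01 y (by simp) with rfl | rfl <;>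
        rcases h01 z (by simp) with rfl | rfl <;> simp [IsSparse, relatedBefore, dAdj] at hω
    obtain ⟨l, a, hl, ha, hequiv⟩ := exists_isRow (by omega) hω hle
    have hs := hequiv.isSparse dAdj_symm hω
    have hf := hequiv.hasFork hfork
    have ha' : ∀ x ∈ a, x ≤ N := fun x hx => by have := ha x hx; omega
    have hsa := hs.of_append
    have hbad : ∀ m, 1 ≤ m → ∀ i ν, ν ∈ normalWords N i → m ≤ i + 1 → CommEquiv dAdj a ν →
        ¬ IsSparse dAdj (List.range' m (N + 2 - m) ++ a) := by
      intro m hm i ν hν hmi he hs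
      obtain ⟨h₁, h₂, -⟩ := relatedBefore_normalWords hν
      rw [← he.relatedBefore_eq dAdj_symm] at h₂
      exact not_isSparse_range'_append (by omega) hmi (by omega) h₂ hs
    cases hl with
    | nil =>
      obtain ⟨j, ν, hν, he⟩ := ih hsa ha' hf
      have := (relatedBefore_normalWords hν).1
      exact ⟨j, ν, mem_normalWords_succ.2 ⟨by omega, .inr (.inl hν)⟩, hequiv.trans he⟩
    | asc m hm hmN =>
      have hfa := hf.of_append fun x hx => by rw [List.mem_range'_1] at hx; omega
      obtain ⟨i, ν, hν, he⟩ := ih hsa ha' hfa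
      rcases Nat.lt_or_ge (i + 1) m with h | h
      · refine ⟨m - 1, _, mem_normalWords_succ.2 ⟨by omega, .inr (.inr ⟨i, by omega, ν, hν, rfl⟩)⟩,
          ?_⟩
        rw [show m - 1 + 1 = m by omega, show N + 1 - (m - 1) = N + 1 + 1 - m by omega]
        exact hequiv.trans (he.append_left _)
      · exact absurd hs (hbad m (by omega) i ν hν h he)
    | zero =>
      obtain ⟨N, rfl⟩ := Nat.exists_eq_add_of_le' hN
      have hfa : HasFork a := by
        rw [show N + 1 + 1 - 1 = N + 1 by omega, List.range'_succ] at hf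
        exact hf.of_cons_two.of_append fun x hx => by rw [List.mem_range'_1] at hx; omega
      obtain ⟨i, ν, hν, he⟩ := ih hsa ha' hfa
      rcases i with _ | i
      · have h₁ := (relatedBefore_normalWords hν).2.2 rfl
        rw [← he.relatedBefore_eq dAdj_symm] at h₁
        have h₂ : 2 ≤ relatedBefore dAdj 0 (List.range' 2 (N + 1) ++ a) := hs.1
        rw [relatedBefore_zero_range'] at h₂
        omega
      · exact absurd hs.2 (hbad 2 (by omega) _ ν hν (by omega) he)
    | one =>
      obtain ⟨N, rfl⟩ := Nat.exists_eq_add_of_le' hN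
      have hfa : HasFork a := by
        rw [show N + 1 + 1 - 1 = N + 1 by omega, List.range'_succ] at hf
        exact hf.of_cons_two.of_append fun x hx => by rw [List.mem_range'_1] at hx; omega
      obtain ⟨i, ν, hν, he⟩ := ih hsa ha' hfa
      rw [one_cons_range'] at hs
      exact absurd hs (hbad 1 le_rfl i ν hν (by omega) he)
    | fork j hj =>
      rcases a with _ | ⟨x, t⟩
      · exact ⟨j, _, mem_normalWords_succ.2 ⟨by omega, .inl rfl⟩, by simpa using hequiv⟩
      · exfalso
        obtain ⟨l, hl⟩ := forkRow_eq_append (N + 1) j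
        rw [hl, List.append_assoc] at hs
        have h₁ := hs.of_append
        have hx := ha' x (by simp)
        rw [List.cons_append, List.cons_append, show N + 1 - 1 = N by omega] at h₁
        rcases Nat.eq_zero_or_pos x with rfl | hx'
        · have h₂ := h₁.1
          obtain ⟨N, rfl⟩ := Nat.exists_eq_add_of_le' hN
          rw [relatedBefore_cons_of_not_adj _ (by unfold dAdj; omega) (by omega),
            relatedBefore_zero_range', relatedBefore_self] at h₂
          omega
        · have h₂ := h₁.2
          rw [← List.cons_append, one_cons_range'] at h₂
          exact not_isSparse_range'_append hx' hx' (by omega) (relatedBefore_self x t) h₂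

end TypeD

/-! ### The action on signed integers -/

section SignedAction

/-- The action on `ℤ` of the `i`th generator of the group of type `D` by even-signed
permutations. -/
def signedSwap : ℕ → ℤ → ℤ
  | 0, x => if x = 1 then -2 else if x = 2 then -1 else if x = -1 then 2 else if x = -2 then 1
      else x
  | i + 1, x => if x = i + 1 then i + 2 else if x = i + 2 then i + 1 else
      if x = -(i + 1) then -(i + 2) else if x = -(i + 2) then -(i + 1) else x

theorem signedSwap_signedSwap (i : ℕ) (x : ℤ) : signedSwap i (signedSwap i x) = x := by
  rcases i with _ | i <;> grind (splits := 30) [signedSwap]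

theorem signedSwap_comm {i j : ℕ} (hij : i ≠ j) (h : ¬ dAdj i j) (x : ℤ) :
    signedSwap i (signedSwap j x) = signedSwap j (signedSwap i x) := by
  rcases i with _ | i <;> rcases j with _ | j
  · exact absurd rfl hij
  · rcases j with _ | _ | j
    · grind (splits := 30) [signedSwap]
    · simp [dAdj] at h
    · grind (splits := 30) [signedSwap]
  · rcases i with _ | _ | i
    · grind (splits := 30) [signedSwap]
    · simp [dAdj] at h
    · grind (splits := 30) [signedSwap]
  · have : i + 1 ≠ j ∧ j + 1 ≠ i := by unfold dAdj at h; omega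
    grind (splits := 30) [signedSwap]

theorem signedSwap_braid {i j : ℕ} (h : dAdj i j) (x : ℤ) :
    signedSwap i (signedSwap j (signedSwap i x)) =
      signedSwap j (signedSwap i (signedSwap j x)) := by
  wlog hlt : i < j generalizing i j
  · exact (this (dAdj_symm _ _ h) (by unfold dAdj at h; omega)).symm
  rcases i with _ | i
  · obtain rfl : j = 2 := by unfold dAdj at h; omega
    grind (splits := 30) [signedSwap]
  · obtain rfl : j = i + 1 + 1 := by unfold dAdj at h; omega
    grind (splits := 30) [signedSwap]

/-- The action of a word on `ℤ`, where the last letter acts first. -/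
def signedAction (a : List ℕ) (x : ℤ) : ℤ := a.foldr signedSwap x

theorem signedAction_append (a b : List ℕ) (x : ℤ) :
    signedAction (a ++ b) x = signedAction a (signedAction b x) :=
  List.foldr_append

theorem signedAction_injective (a : List ℕ) : Function.Injective (signedAction a) := by
  induction a with
  | nil => exact fun _ _ h => h
  | cons i a ih =>
    exact (Function.LeftInverse.injective (signedSwap_signedSwap i)).comp ih

theorem signedAction_of_lt {a : List ℕ} {m : ℕ} (hm : 3 ≤ m) (h : ∀ y ∈ a, y + 1 < m) :
    signedAction a m = m := by
  induction a with
  | nil => rfl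
  | cons y a ih =>
    have hy := h y (by simp)
    change signedSwap y (signedAction a m) = m
    rw [ih fun z hz => h z (by simp [hz])]
    rcases y with _ | y <;> grind (splits := 30) [signedSwap]

theorem signedAction_range' {m : ℕ} (len : ℕ) (hm : 1 ≤ m) :
    signedAction (List.range' m len) ((m + len : ℕ) : ℤ) = m := by
  induction len generalizing m with
  | zero => rfl
  | succ len ih =>
    have := ih (m := m + 1) (by omega)
    rw [show m + 1 + len = m + (len + 1) by omega] at this
    rw [List.range'_succ]
    change signedSwap m (signedAction _ _) = m
    rw [this]
    rcases m with _ | m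
    · omega
    · grind (splits := 30) [signedSwap]

theorem signedAction_forkRow {N : ℕ} (hN : 1 ≤ N) (j : ℕ) :
    signedAction (forkRow N j) ((N + 1 : ℕ) : ℤ) = -(j + 2) := by
  induction j with
  | zero =>
    have := signedAction_range' (m := 2) (N - 1) (by omega)
    rw [show 2 + (N - 1) = N + 1 by omega] at this
    change signedSwap 0 (signedSwap 1 (signedAction _ _)) = _
    rw [this]
    rfl
  | succ j ih =>
    change signedSwap (j + 2) (signedAction _ _) = _
    rw [ih]
    grind (splits := 30) [signedSwap]

theorem signedAction_normalWords {N j : ℕ} {ν : List ℕ} (h : ν ∈ normalWords N j) :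
    signedAction ν ((N + 2 : ℕ) : ℤ) = (N + 2 : ℕ) := by
  have := (relatedBefore_normalWords h).1
  exact signedAction_of_lt (by omega) fun y hy => by
    have := (normalWords_spec h).1 y hy
    omega

/-- Distinct normal words act differently. -/
theorem eq_of_signedAction_eq {N j j' : ℕ} {a b : List ℕ} (ha : a ∈ normalWords N j)
    (hb : b ∈ normalWords N j') (h : ∀ x, signedAction a x = signedAction b x) :
    a = b ∧ j = j' := by
  induction N generalizing j j' a b with
  | zero => simp [normalWords] at ha
  | succ N ih =>
    have hfork : ∀ k : ℕ, signedAction (forkRow (N + 1) k) ((N + 2 : ℕ) : ℤ) = -(k + 2) :=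
      fun k => signedAction_forkRow (by omega) k
    have hasc : ∀ k i μ, k ≤ N → μ ∈ normalWords N i →
        signedAction (List.range' (k + 1) (N + 1 - k) ++ μ) ((N + 2 : ℕ) : ℤ) = k + 1 := by
      intro k i μ hk hμ
      have := signedAction_range' (m := k + 1) (N + 1 - k) (by omega)
      rw [show k + 1 + (N + 1 - k) = N + 2 by omega] at this
      rw [signedAction_append, signedAction_normalWords hμ, this]
      norm_cast
    have hpt := h ((N + 2 : ℕ) : ℤ)
    rw [mem_normalWords_succ] at ha hb
    obtain ⟨hj, rfl | ha | ⟨i, hi, μ, hμ, rfl⟩⟩ := ha <;>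
      obtain ⟨hj', rfl | hb | ⟨i', hi', μ', hμ', rfl⟩⟩ := hb
    · rw [hfork, hfork] at hpt
      obtain rfl : j = j' := by omega
      exact ⟨rfl, rfl⟩
    · rw [hfork, signedAction_normalWords hb] at hpt
      omega
    · rw [hfork, hasc _ _ _ hj' hμ'] at hpt
      omega
    · rw [hfork, signedAction_normalWords ha] at hpt
      omega
    · exact ih ha hb h
    · rw [hasc _ _ _ hj' hμ', signedAction_normalWords ha] at hpt
      omega
    · rw [hfork, hasc _ _ _ hj hμ] at hpt
      omega
    · rw [hasc _ _ _ hj hμ, signedAction_normalWords hb] at hpt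
      omega
    · rw [hasc _ _ _ hj hμ, hasc _ _ _ hj' hμ'] at hpt
      obtain rfl : j = j' := by omega
      refine ⟨?_, rfl⟩
      rw [(ih hμ hμ' fun x => ?_).1]
      have := h x
      rw [signedAction_append, signedAction_append] at this
      exact signedAction_injective _ this

end SignedAction

/-! ### Counting normal words -/

section Counting

theorem card_normalWords_succ {N j : ℕ} (hj : j ≤ N) :
    (normalWords (N + 1) j).card = 1 + ∑ i ∈ Finset.range (j + 1), (normalWords N i).card := by
  have hpt : ∀ {i i' : ℕ} {μ μ' : List ℕ}, μ ∈ normalWords N i → μ' ∈ normalWords N i' →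
      List.range' (j + 1) (N + 1 - j) ++ μ ≠ μ' := by
    intro i i' μ μ' hμ hμ' h
    have h₁ : N + 1 ∈ List.range' (j + 1) (N + 1 - j) ++ μ := by
      rw [List.mem_append, List.mem_range'_1]
      omega
    have := (normalWords_spec hμ').1 _ (h ▸ h₁)
    omega
  have hneg : ∀ {i : ℕ} {μ : List ℕ}, μ ∈ normalWords N i →
      forkRow (N + 1) j ≠ List.range' (j + 1) (N + 1 - j) ++ μ := by
    intro i μ hμ h
    have h₁ := signedAction_forkRow (N := N + 1) (by omega) j
    have h₂ := signedAction_range' (m := j + 1) (N + 1 - j) (by omega)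
    rw [show j + 1 + (N + 1 - j) = N + 2 by omega] at h₂
    rw [h, signedAction_append, signedAction_normalWords hμ, h₂] at h₁
    omega
  rw [normalWords, if_pos hj, Finset.card_insert_of_notMem, Finset.card_union_of_disjoint,
    Finset.card_biUnion, Finset.sum_range_succ]
  · simp only [Finset.card_image_of_injective _ (List.append_right_injective _)]
    omega
  · intro i _ i' _ hne
    rw [Function.onFun, Finset.disjoint_left]
    simp only [Finset.mem_image]
    rintro _ ⟨μ, hμ, rfl⟩ ⟨μ', hμ', h⟩
    rw [List.append_right_injective _ h] at hμ'
    exact hne (eq_of_signedAction_eq hμ hμ' fun _ => rfl).2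
  · rw [Finset.disjoint_left]
    simp only [Finset.mem_biUnion, Finset.mem_image]
    rintro ν hν ⟨i, _, μ, hμ, h⟩
    exact hpt hμ hν h
  · simp only [Finset.mem_union, Finset.mem_biUnion, Finset.mem_image, not_or]
    refine ⟨fun h => ?_, ?_⟩
    · have h₁ := signedAction_forkRow (N := N + 1) (by omega) j
      rw [signedAction_normalWords h] at h₁
      omega
    · rintro ⟨i, _, μ, hμ, h⟩
      exact hneg hμ h.symm

theorem card_normalWords_self (N : ℕ) : (normalWords N N).card = 0 := by
  rcases N with _ | N <;> simp [normalWords]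

/-- Ballot numbers count normal words with given initial letter. -/
theorem card_normalWords {N j : ℕ} (hj : j ≤ N) :
    (normalWords N j).card + (N + j + 1).choose j = (N + j + 1).choose (j + 1) ∧
      1 + ∑ i ∈ Finset.range (j + 1), (normalWords N i).card + (N + j + 2).choose j =
        (N + j + 2).choose (j + 1) := by
  induction N generalizing j with
  | zero =>
    obtain rfl : j = 0 := by omega
    simp [normalWords]
  | succ N ih =>
    have h₁ : ∀ j ≤ N + 1, (normalWords (N + 1) j).card + (N + 1 + j + 1).choose j =
        (N + 1 + j + 1).choose (j + 1) := by
      intro j hj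
      rcases Nat.lt_or_ge N j with h | h
      · obtain rfl : j = N + 1 := by omega
        rw [card_normalWords_self, zero_add]
        exact Nat.choose_symm_of_eq_add (by omega)
      · rw [card_normalWords_succ h, show N + 1 + j + 1 = N + j + 2 by omega]
        exact (ih h).2
    refine ⟨h₁ j hj, ?_⟩
    induction j with
    | zero =>
      have := h₁ 0 hj
      simp at this ⊢
      omega
    | succ j ihj =>
      have h₂ := ihj (by omega)
      have h₃ := h₁ (j + 1) hj
      rw [Finset.sum_range_succ]
      rw [show N + 1 + (j + 1) + 1 = N + 1 + j + 2 by omega] at h₃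
      rw [show N + 1 + (j + 1) + 2 = N + 1 + j + 2 + 1 by omega,
        Nat.choose_succ_succ' _ j, Nat.choose_succ_succ' _ (j + 1)]
      omega

theorem sum_card_normalWords (N : ℕ) :
    ∑ j ∈ Finset.range N, (normalWords N j).card = catalan (N + 1) - 1 := by
  have h₁ := (card_normalWords (le_refl N)).2
  rw [Finset.sum_range_succ, card_normalWords_self] at h₁
  have h₂ := succ_mul_catalan_eq_centralBinom (N + 1)
  have h₃ := Nat.choose_succ_right_eq (N + N + 2) N
  rw [Nat.centralBinom, show 2 * (N + 1) = N + N + 2 by omega] at h₂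
  rw [show N + N + 2 - N = N + 2 by omega] at h₃
  have h₄ : (N + 2) * catalan (N + 1) =
      (N + 2) * (1 + ∑ j ∈ Finset.range N, (normalWords N j).card) := by
    rw [← h₁] at h₂ h₃
    nlinarith
  have := Nat.eq_of_mul_eq_mul_left (by omega) h₄
  omega

end Counting

/-! ### Reduced words in the group of type `D` -/

section ReducedWords

variable {n : ℕ}

theorem DnMatrix_apply (i j : Fin n) :
    DnMatrix n i j = if i = j then 1 else if DnAdj n i j then 3 else 2 := rfl

theorem isSimplyLaced_DnMatrix (n : ℕ) : IsSimplyLaced (DnMatrix n) := by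
  intro i j hij
  rw [DnMatrix_apply, if_neg hij]
  split_ifs <;> simp

theorem linked_DnMatrix_iff {i j : Fin n} : (DnMatrix n).Linked i j ↔ dAdj i j := by
  rw [CoxeterMatrix.Linked, DnMatrix_apply]
  change _ ↔ DnAdj n i j
  split_ifs with h₁ h₂
  · subst h₁
    simp [DnAdj]
    omega
  · simp [h₂]
  · simp [h₂]

/-- `signedSwap` as a permutation. -/
def signedPerm (i : ℕ) : Equiv.Perm ℤ :=
  Function.Involutive.toPerm (signedSwap i) (signedSwap_signedSwap i)

theorem signedPerm_apply (i : ℕ) (x : ℤ) : signedPerm i x = signedSwap i x := rfl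

theorem isLiftable_signedPerm (n : ℕ) :
    (DnMatrix n).IsLiftable fun i : Fin n => signedPerm i := by
  intro i j
  rw [DnMatrix_apply]
  split_ifs with h₁ h₂
  · subst h₁
    ext x
    simp [signedPerm_apply, signedSwap_signedSwap]
  · ext x
    have h₃ : dAdj i j := h₂
    simp [pow_succ, signedPerm_apply, signedSwap_braid h₃, signedSwap_signedSwap]
  · ext x
    have h₃ : ¬ dAdj i j := h₂
    have h₄ : (i : ℕ) ≠ j := fun h => h₁ (Fin.ext h)
    simp [pow_succ, signedPerm_apply, signedSwap_comm h₄ h₃, signedSwap_signedSwap]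

theorem signedAction_eq_of_wordProd_eq {ω ω' : List (Fin n)}
    (h : (DnMatrix n).toCoxeterSystem.wordProd ω = (DnMatrix n).toCoxeterSystem.wordProd ω')
    (x : ℤ) : signedAction (ω.map Fin.val) x = signedAction (ω'.map Fin.val) x := by
  set cs := (DnMatrix n).toCoxeterSystem
  have key : ∀ a : List (Fin n), cs.lift ⟨_, isLiftable_signedPerm n⟩ (cs.wordProd a) x =
      signedAction (a.map Fin.val) x := by
    intro a
    induction a with
    | nil => simp [signedAction]
    | cons i a ih =>
      rw [cs.wordProd_cons, map_mul, cs.lift_apply_simple, Equiv.Perm.mul_apply, ih]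
      rfl
  rw [← key, ← key, h]

theorem simple_injective_DnMatrix (n : ℕ) :
    Function.Injective (DnMatrix n).toCoxeterSystem.simple := by
  intro i j h
  have h' := signedAction_eq_of_wordProd_eq (ω := [i]) (ω' := [j]) (by simpa using h)
  have h₁ : ∀ x, signedSwap i x = signedSwap j x := h'
  apply Fin.ext
  generalize (i : ℕ) = i at h₁
  generalize (j : ℕ) = j at h₁
  rcases i with _ | i
  · rcases j with _ | j
    · rfl
    · have := h₁ 1
      grind [signedSwap]
  · rcases j with _ | j
    · have := h₁ 1
      have := h₁ (i + 1)
      grind [signedSwap]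
    · have := h₁ (i + 1)
      grind [signedSwap]

theorem simple_mul_simple_ne_DnMatrix {i j : Fin n} (h : DnMatrix n i j = 3) :
    (DnMatrix n).toCoxeterSystem.simple i * (DnMatrix n).toCoxeterSystem.simple j ≠
      (DnMatrix n).toCoxeterSystem.simple j * (DnMatrix n).toCoxeterSystem.simple i := by
  intro hc
  have h₁ := simple_braid (DnMatrix n).toCoxeterSystem h
  rw [hc, CoxeterSystem.simple_mul_simple_cancel_left, ← hc,
    CoxeterSystem.simple_mul_simple_cancel_left] at h₁
  obtain rfl := simple_injective_DnMatrix n h₁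
  rw [(DnMatrix n).diagonal] at h
  omega

theorem isSparse_map_val {ω : List (Fin n)} :
    IsSparse dAdj (ω.map Fin.val) ↔ IsSparse (DnMatrix n).Linked ω := by
  have key : ∀ (i : Fin n) (a : List (Fin n)),
      relatedBefore dAdj (i : ℕ) (a.map Fin.val) = relatedBefore (DnMatrix n).Linked i a := by
    intro i a
    induction a with
    | nil => rfl
    | cons j a ih =>
      simp only [List.map_cons, relatedBefore, ih, linked_DnMatrix_iff, Fin.ext_iff]
  induction ω with
  | nil => rfl
  | cons i ω ih => simp only [List.map_cons, IsSparse, key, ih]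

/-- The letter `i` as a generator index, if it is one. -/
def toIndex (n i : ℕ) : Option (Fin n) := if h : i < n then some ⟨i, h⟩ else none

theorem filterMap_toIndex_map_val (ω : List (Fin n)) :
    (ω.map Fin.val).filterMap (toIndex n) = ω := by
  induction ω with
  | nil => rfl
  | cons i ω ih => simp [toIndex, ih]

theorem map_val_filterMap_toIndex {a : List ℕ} (h : ∀ i ∈ a, i < n) :
    (a.filterMap (toIndex n)).map Fin.val = a := by
  induction a with
  | nil => rfl
  | cons i a ih =>
    have hi := h i (by simp)
    have := ih fun j hj => h j (by simp [hj])
    simp [toIndex, hi] at this ⊢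
    exact this

theorem CommEquiv.filterMap_toIndex {a b : List ℕ} (h : CommEquiv dAdj a b) :
    CommEquiv (DnMatrix n).Linked (a.filterMap (toIndex n)) (b.filterMap (toIndex n)) := by
  induction h with
  | refl => exact .refl _
  | swap i j a hne hadj =>
    by_cases hi : i < n <;> by_cases hj : j < n <;> simp [toIndex, hi, hj]
    all_goals first | exact .refl _ | skip
    exact .swap _ _ _ (by simpa using hne) (by rwa [linked_DnMatrix_iff])
  | cons i _ ih =>
    rw [List.filterMap_cons, List.filterMap_cons]
    cases toIndex n i with
    | none => exact ih
    | some i => exact ih.cons i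
  | trans _ _ ih₁ ih₂ => exact ih₁.trans ih₂

end ReducedWords

/-- For `n ≥ 4`, the number of fully commutative elements of `W(Dₙ)` of *type I* — those
such that some reduced word contains `s₁̄ s₁` (indices `0, 1`) as a contiguous subword —
equals `C(n) − 1`, where `C(n)` is the `n`-th Catalan number. -/
theorem card_fullyCommutative_typeI_Dn (n : ℕ) (hn : 4 ≤ n) :
    Nat.card {w : (DnMatrix n).Group |
        IsFullyCommutative (DnMatrix n).toCoxeterSystem w ∧
        ∃ ω : List (Fin n), (DnMatrix n).toCoxeterSystem.IsReduced ω ∧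
          (DnMatrix n).toCoxeterSystem.wordProd ω = w ∧
          ([⟨0, by omega⟩, ⟨1, by omega⟩] : List (Fin n)).IsInfix ω} =
      catalan n - 1 := by
  have hM := isSimplyLaced_DnMatrix n
  have hlinked : ∀ i j, (DnMatrix n).Linked i j → (DnMatrix n).Linked j i := fun _ _ h => h.symm
  set cs := (DnMatrix n).toCoxeterSystem
  obtain ⟨N, rfl⟩ := Nat.exists_eq_add_of_le' (show 1 ≤ n by omega)
  let words := (Finset.range N).biUnion (normalWords N)
  have hlt : ∀ ν ∈ words, ∀ i ∈ ν, i < N + 1 := by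
    intro ν hν i hi
    obtain ⟨j, -, hν⟩ := Finset.mem_biUnion.1 hν
    exact Nat.lt_succ_of_le ((normalWords_spec hν).1 i hi)
  let f : List ℕ → (DnMatrix (N + 1)).Group := fun ν => cs.wordProd (ν.filterMap (toIndex (N + 1)))
  have hf : Set.InjOn f words := by
    intro a ha b hb hab
    have hact := signedAction_eq_of_wordProd_eq hab
    rw [map_val_filterMap_toIndex (hlt a ha), map_val_filterMap_toIndex (hlt b hb)] at hact
    obtain ⟨j, -, ha⟩ := Finset.mem_biUnion.1 ha
    obtain ⟨j', -, hb⟩ := Finset.mem_biUnion.1 hb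
    exact (eq_of_signedAction_eq ha hb hact).1
  have hset : {w : (DnMatrix (N + 1)).Group | IsFullyCommutative cs w ∧
      ∃ ω : List (Fin (N + 1)), cs.IsReduced ω ∧ cs.wordProd ω = w ∧
        ([⟨0, by omega⟩, ⟨1, by omega⟩] : List (Fin (N + 1))).IsInfix ω} = f '' words := by
    ext w
    constructor
    · rintro ⟨hfc, ω, hω, rfl, hinf⟩
      have hfork : HasFork (ω.map Fin.val) := by
        left
        simpa using (hinf.map Fin.val).filter (· ≤ 2)
      obtain ⟨j, ν, hν, he⟩ := exists_normalWord (N := N)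
        (isSparse_map_val.2 (hfc.isSparse cs hM hω)) (fun x hx => by
          obtain ⟨i, -, rfl⟩ := List.mem_map.1 hx
          omega) hfork
      refine ⟨ν, Finset.mem_biUnion.2
        ⟨j, Finset.mem_range.2 (relatedBefore_normalWords hν).1, hν⟩, ?_⟩
      have := (he.filterMap_toIndex (n := N + 1)).wordProd_eq cs hM
      rw [filterMap_toIndex_map_val] at this
      exact this.symm
    · rintro ⟨ν, hν, rfl⟩
      have hmap := map_val_filterMap_toIndex (hlt ν hν)
      obtain ⟨j, -, hν⟩ := Finset.mem_biUnion.1 hν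
      obtain ⟨-, hinf, hsparse, -⟩ := normalWords_spec hν
      rw [← hmap, isSparse_map_val] at hsparse
      obtain ⟨hred, hequiv⟩ := hsparse.isReduced_and_commEquiv cs hM
        (simple_injective_DnMatrix _) (fun _ _ h => simple_mul_simple_ne_DnMatrix h)
      refine ⟨fun ω ω' h₁ h₂ h₃ h₄ => ?_, _, hred, rfl, ?_⟩
      · exact (((hequiv ω h₁ h₃).symm hlinked).trans (hequiv ω' h₂ h₄)).reflTransGen hM
      · have := hinf.filterMap (toIndex (N + 1))
        have h1 : 1 < N + 1 := by omega
        simpa [toIndex, h1] using this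
  rw [hset, Nat.card_image_of_injOn hf, Nat.card_coe_set_eq, Set.ncard_coe_finset,
    Finset.card_biUnion, sum_card_normalWords]
  intro i _ i' _ hne
  rw [Function.onFun, Finset.disjoint_left]
  exact fun ν hν hν' => hne (eq_of_signedAction_eq hν hν' fun _ => rfl).2

end
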